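/- arXiv:1512.02078 — 3 statements merged into one kernel-verified Lean document; each statement's English description precedes it below -/
import Mathlib

section
/- (Validity of the no-miracles axiom) For all i ∈ I, all a, b ∈ A with a ↭_i b, every LDEL formula φ and every formula φ^o_i of the form (⋀_{p∈B} p_i) ∧ (⋀_{p∉B} ¬p_i) for some B ⊆ P, the formula K̂_i⟨b⟩(φ ∧ φ^o_i) → [a](φ^o_i → K̂_i φ) holds at every world of every epistemic model with respect to every game structure under the dynamic semantics ⊨. -/
namespace GameRuns

/-- An observation model: an equivalence relation on actions for each player. -/
structure ObsModel (I A : Type) where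
  rel : I → A → A → Prop
  equiv : ∀ i, Equivalence (rel i)

/-- The data of a game structure: a partial transition function and game information. -/
structure GameData (I A P S : Type) where
  R : S → A → Option S
  O : S → I → Set P

/-- `G` is a game structure w.r.t. the player assignment `pl` and the
distinguished information pieces `pa`. -/
def IsGameStructure {I A P S : Type} (pl : A → I) (pa : A → P) (G : GameData I A P S) : Prop :=
  Nonempty S ∧
  (∀ s a b, (G.R s a).isSome → (G.R s b).isSome → pl a = pl b) ∧
  (∀ s a, pa a ∈ G.O s (pl a) ↔ (G.R s a).isSome)

/-- The data of an epistemic model w.r.t. a game structure over states `S`. -/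
structure EpiData (I A P S : Type) (W : Type) where
  f : W → S
  sim : I → W → W → Prop
  V : W → I → Set P

/-- `M` is an epistemic model w.r.t. the game structure `G`. -/
def IsEpiModel {I A P S W : Type} (G : GameData I A P S) (M : EpiData I A P S W) : Prop :=
  Nonempty W ∧
  (∀ i, Equivalence (M.sim i)) ∧
  (∀ i w v, M.sim i w v → G.O (M.f w) i = G.O (M.f v) i) ∧
  (∀ w i, M.V w i = G.O (M.f w) i)

variable {I A P S : Type}

/-- Carrier of the update product `M ⊗ U`. -/
abbrev UpdW (G : GameData I A P S) {W : Type} (M : EpiData I A P S W) : Type :=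
  {x : W × A // (G.R (M.f x.1) x.2).isSome}

/-- The update product `M ⊗ U`. -/
def update (G : GameData I A P S) (U : ObsModel I A) {W : Type} (M : EpiData I A P S W) :
    EpiData I A P S (UpdW G M) where
  f x := (G.R (M.f x.val.1) x.val.2).get x.prop
  sim i x y := M.sim i x.val.1 y.val.1 ∧ U.rel i x.val.2 y.val.2 ∧
    G.O ((G.R (M.f x.val.1) x.val.2).get x.prop) i =
      G.O ((G.R (M.f y.val.1) y.val.2).get y.prop) i
  V x i := G.O ((G.R (M.f x.val.1) x.val.2).get x.prop) i

/-- The data of an epistemic temporal model. -/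
structure ETLData (I A P : Type) (W : Type) where
  sim : I → W → W → Prop
  trans : A → W → W → Prop
  V : W → I → Set P

/-- `N` is an epistemic temporal model: nonempty carrier, equivalence relations. -/
def IsETL {W : Type} (N : ETLData I A P W) : Prop :=
  Nonempty W ∧ ∀ i, Equivalence (N.sim i)

/-- The set of actions available at a state of an epistemic temporal model. -/
def Act {W : Type} (N : ETLData I A P W) (s : W) : Set A := {a | ∃ t, N.trans a s t}

/-- Normality of an epistemic temporal model w.r.t. an observation model:
no miracles, perfect recall, determinism, exclusive turns, info and knowledge of
own information. -/
def Normal (pl : A → I) (pa : A → P) (U : ObsModel I A) {W : Type}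
    (N : ETLData I A P W) : Prop :=
  (∀ i a b s s' t t', N.sim i s s' → N.trans a s' t' → N.trans b s t →
      U.rel i b a → N.V t i = N.V t' i → N.sim i t t') ∧
  (∀ i a s t t', N.trans a s t → N.sim i t t' →
      ∃ s' b, N.sim i s s' ∧ U.rel i a b ∧ N.trans b s' t') ∧
  (∀ a s t t', N.trans a s t → N.trans a s t' → t = t') ∧
  (∀ s : W, (Act N s).Nonempty → ∃ j, ∀ a ∈ Act N s, pl a = j) ∧
  (∀ s a, pa a ∈ N.V s (pl a) ↔ ∃ t, N.trans a s t) ∧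
  (∀ i w v, N.sim i w v → N.V w i = N.V v i)

/-- A bundled epistemic model (carrier together with the model). -/
structure BEpi (I A P S : Type) where
  W : Type
  M : EpiData I A P S W

/-- Bundled update. -/
def bUpdate (G : GameData I A P S) (U : ObsModel I A) (B : BEpi I A P S) : BEpi I A P S :=
  ⟨UpdW G B.M, update G U B.M⟩

/-- Iterated update `M ⊗ U^k`. -/
def iter (G : GameData I A P S) (U : ObsModel I A) (B : BEpi I A P S) : ℕ → BEpi I A P S
  | 0 => B
  | k + 1 => bUpdate G U (iter G U B k)

/-- Carrier of the run model generated by repeatedly updating `U`: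
states of level `k` are the states of `M ⊗ U^k`. -/
abbrev RunW (G : GameData I A P S) (U : ObsModel I A) (B : BEpi I A P S) : Type :=
  Σ k : ℕ, (iter G U B k).W

/-- The successor state `(w, a)` of `w` in the next level of the run model. -/
def stepUp (G : GameData I A P S) (U : ObsModel I A) (B : BEpi I A P S) (k : ℕ)
    (w : (iter G U B k).W) (a : A) (h : (G.R ((iter G U B k).M.f w) a).isSome) :
    (iter G U B (k + 1)).W :=
  ⟨(w, a), h⟩

/-- Epistemic relation of the run model. -/
def runSim (G : GameData I A P S) (U : ObsModel I A) (B : BEpi I A P S) (i : I) :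
    RunW G U B → RunW G U B → Prop := fun x y =>
  ∃ h : x.1 = y.1,
    (iter G U B y.1).M.sim i (cast (congrArg (fun k => (iter G U B k).W) h) x.2) y.2

/-- Action relation of the run model. -/
def runTrans (G : GameData I A P S) (U : ObsModel I A) (B : BEpi I A P S) (a : A) :
    RunW G U B → RunW G U B → Prop := fun x y =>
  ∃ h : (G.R ((iter G U B x.1).M.f x.2) a).isSome,
    y = ⟨x.1 + 1, stepUp G U B x.1 x.2 a h⟩

/-- The run model `F⊗(M)` generated by repeatedly updating `U`. -/
def runModel (G : GameData I A P S) (U : ObsModel I A) (B : BEpi I A P S) :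
    ETLData I A P (RunW G U B) where
  sim := runSim G U B
  trans := runTrans G U B
  V x i := (iter G U B x.1).M.V x.2 i

/-- The induced state assignment function of the run model. -/
def runF (G : GameData I A P S) (U : ObsModel I A) (B : BEpi I A P S) :
    RunW G U B → S := fun x => (iter G U B x.1).M.f x.2



section More
variable {I A P S : Type}

/-- The state reached by following a list of actions from `s`, if it exists. -/
def runPath (G : GameData I A P S) : S → List A → Option S
  | s, [] => some s
  | s, a :: l => (G.R s a).bind fun t => runPath G t l

theorem runPath_append (G : GameData I A P S) (s : S) (l : List A) (a : A) :
    runPath G s (l ++ [a]) = (runPath G s l).bind fun t => G.R t a := by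
  induction l generalizing s with
  | nil => simp [runPath]
  | cons b l ih =>
    simp only [List.cons_append, runPath]
    cases h : G.R s b with
    | none => simp
    | some t => simp [ih]

/-- The initial world and the sequence of actions of a state of the run model. -/
def runActs (G : GameData I A P S) (U : ObsModel I A) (B : BEpi I A P S) :
    (k : ℕ) → (iter G U B k).W → B.W × List A
  | 0, w => (w, [])
  | k + 1, w =>
      ((runActs G U B k w.val.1).1, (runActs G U B k w.val.1).2 ++ [w.val.2])

theorem runActs_path (G : GameData I A P S) (U : ObsModel I A) (B : BEpi I A P S) :
    ∀ (k : ℕ) (w : (iter G U B k).W),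
      runPath G (B.M.f (runActs G U B k w).1) (runActs G U B k w).2 =
        some ((iter G U B k).M.f w) := by
  intro k
  induction k with
  | zero => intro w; rfl
  | succ k ih =>
    intro w
    have h1 := ih w.val.1
    show runPath G _ _ = some ((update G U (iter G U B k).M).f w)
    rw [show runActs G U B (k + 1) w =
        ((runActs G U B k w.val.1).1, (runActs G U B k w.val.1).2 ++ [w.val.2]) from rfl]
    rw [runPath_append, h1]
    exact (Option.some_get w.prop).symm

/-- Carrier of the epistemic game tree generatedfrom `s`: valid histories. -/
abbrev TreeW (G : GameData I A P S) (s : S) : Type := {l : List A // (runPath G s l).isSome}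

/-- The epistemic game tree generated from `s` with perfect recall,
viewed as an epistemic temporal model. -/
def tree (G : GameData I A P S) (s : S) : ETLData I A P (TreeW G s) where
  sim i w u := w.val.length = u.val.length ∧
    ∀ k, (runPath G s (w.val.take k)).map (fun t => G.O t i) =
      (runPath G s (u.val.take k)).map (fun t => G.O t i)
  trans a w u := u.val = w.val ++ [a]
  V w i := G.O ((runPath G s w.val).get w.prop) i

/-- The tracking function from the run model of a certainty epistemic model to the
epistemic game tree generated from the (common-knowledge) initial state. -/
def tracking (G : GameData I A P S) (U : ObsModel I A) {W : Type} (M : EpiData I A P S W)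
    (v : W) (hv : ∀ x : W, x = v) (x : RunW G U ⟨W, M⟩) : TreeW G (M.f v) :=
  ⟨(runActs G U ⟨W, M⟩ x.1 x.2).2, by
    have h : runPath G (M.f (runActs G U ⟨W, M⟩ x.1 x.2).1)
        (runActs G U ⟨W, M⟩ x.1 x.2).2 = some ((iter G U ⟨W, M⟩ x.1).M.f x.2) :=
      runActs_path G U ⟨W, M⟩ x.1 x.2
    rw [hv (runActs G U ⟨W, M⟩ x.1 x.2).1] at h
    rw [h]
    rfl⟩

/-- `U` is non-informative w.r.t. an epistemic temporal model. -/
def NonInformative (U : ObsModel I A) {W : Type} (N : ETLData I A P W) : Prop :=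
  ∀ i a b w u s t, N.trans a w s → N.trans b u t → N.sim i w u →
    ¬ U.rel i a b → N.V s i ≠ N.V t i

/-- Isomorphism of epistemic temporal models. -/
def IsIso {W W' : Type} (N : ETLData I A P W) (N' : ETLData I A P W') (g : W → W') : Prop :=
  Function.Bijective g ∧
  (∀ i x y, N.sim i x y ↔ N'.sim i (g x) (g y)) ∧
  (∀ a x y, N.trans a x y ↔ N'.trans a (g x) (g y)) ∧
  (∀ x i, N.V x i = N'.V (g x) i)

/-- p-morphisms between epistemic temporal models. -/
def IsPMorphism {W W' : Type} (N : ETLData I A P W) (N' : ETLData I A P W')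
    (g : W → W') : Prop :=
  (∀ w i, N.V w i = N'.V (g w) i) ∧
  (∀ i w u, N.sim i w u → N'.sim i (g w) (g u)) ∧
  (∀ i w s, N'.sim i (g w) s → ∃ v, g v = s ∧ N.sim i w v) ∧
  (∀ a w u, N.trans a w u → N'.trans a (g w) (g u)) ∧
  (∀ a w s, N'.trans a (g w) s → ∃ v, g v = s ∧ N.trans a w v)

/-- The induced epistemic game structure `E(G)`, viewed as an epistemic temporal model. -/
def egame (G : GameData I A P S) : ETLData I A P S where
  sim i s t := G.O s i = G.O t i
  trans a s t := G.R s a = some t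
  V s i := G.O s i

/-- `G` is a perfect information game: the induced epistemic relations are the identity. -/
def PerfectInfo (G : GameData I A P S) : Prop :=
  ∀ i s t, G.O s i = G.O t i → s = t

/-- The game induced by an epistemic temporal model: `R(s,a) = t` iff `s →_a t`. -/
noncomputable def inducedGame {W : Type} (N : ETLData I A P W) : GameData I A P W where
  R s a := @dite _ (∃ t, N.trans a s t) (Classical.propDecidable _)
    (fun h => some h.choose) (fun _ => none)
  O := N.V

/-- The epistemic part induced by an epistemic temporal model. -/
def epiPart {W : Type} (N : ETLData I A P W) : EpiData I A P W W where
  f := id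
  sim := N.sim
  V := N.V

theorem inducedGame_isSome {W : Type} (N : ETLData I A P W) {a : A} {s t : W}
    (h : N.trans a s t) : ((inducedGame N).R s a).isSome := by
  show (@dite _ (∃ t, N.trans a s t) (Classical.propDecidable _)
    (fun h => some h.choose) (fun _ => none)).isSome
  rw [dif_pos ⟨t, h⟩]
  rfl

end More
section Lang
variable {I A P S : Type}

/-- The dynamic epistemic language LDEL. -/
inductive LDEL (I A P : Type) : Type where
  | top : LDEL I A P
  | atom : P → I → LDEL I A P
  | neg : LDEL I A P → LDEL I A P
  | conj : LDEL I A P → LDEL I A P → LDEL I A P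
  | know : I → LDEL I A P → LDEL I A P
  | box : A → LDEL I A P → LDEL I A P

/-- Implication, defined from negation and conjunction. -/
def impF (φ ψ : LDEL I A P) : LDEL I A P := .neg (.conj φ (.neg ψ))

/-- Disjunction. -/
def orF (φ ψ : LDEL I A P) : LDEL I A P := .neg (.conj (.neg φ) (.neg ψ))

/-- Biconditional. -/
def iffF (φ ψ : LDEL I A P) : LDEL I A P := .conj (impF φ ψ) (impF ψ φ)

/-- Diamond `⟨a⟩φ`. -/
def diaF (a : A) (φ : LDEL I A P) : LDEL I A P := .neg (.box a (.neg φ))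

/-- The dual knowledge modality `K̂_i φ`. -/
def khatF (i : I) (φ : LDEL I A P) : LDEL I A P := .neg (.know i (.neg φ))

/-- Finite conjunction. -/
def bigAnd : List (LDEL I A P) → LDEL I A P
  | [] => .top
  | φ :: l => .conj φ (bigAnd l)

/-- Finite disjunction. -/
def bigOr : List (LDEL I A P) → LDEL I A P
  | [] => .neg .top
  | φ :: l => orF φ (bigOr l)

/-- The characteristic formula `φ^o_i` of a combination of information pieces,
where `L1` enumerates the pieces in `B` and `L2` those not in `B`. -/
def charF (i : I) (L1 L2 : List P) : LDEL I A P :=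
  .conj (bigAnd (L1.map (fun p => LDEL.atom p i)))
    (bigAnd (L2.map (fun p => LDEL.neg (LDEL.atom p i))))

/-- `TURN_i`, given an enumeration `l` of the actions of player `i`. -/
def turnF (l : List A) : LDEL I A P := bigOr (l.map (fun a => diaF a LDEL.top))

/-- Propositional evaluation treating atoms, `K_i ψ` and `[a]ψ` as atomic. -/
def propEval (v : LDEL I A P → Prop) : LDEL I A P → Prop
  | .top => True
  | .neg φ => ¬ propEval v φ
  | .conj φ ψ => propEval v φ ∧ propEval v ψ
  | φ => v φ

/-- The dynamic (DEL-style) semantics `⊨` over epistemic models w.r.t. a game structure. -/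
def dynSat (G : GameData I A P S) (U : ObsModel I A) :
    LDEL I A P → (W : Type) → EpiData I A P S W → W → Prop
  | .top, _, _, _ => True
  | .atom p i, _, M, w => p ∈ M.V w i
  | .neg φ, W, M, w => ¬ dynSat G U φ W M w
  | .conj φ ψ, W, M, w => dynSat G U φ W M w ∧ dynSat G U ψ W M w
  | .know i φ, W, M, w => ∀ v, M.sim i w v → dynSat G U φ W M v
  | .box a φ, _, M, w => ∀ h : (G.R (M.f w) a).isSome,
      dynSat G U φ (UpdW G M) (update G U M) ⟨(w, a), h⟩

/-- The epistemic temporal (ETL-style) semantics `⊩`. -/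
def etlSat {W : Type} (N : ETLData I A P W) : LDEL I A P → W → Prop
  | .top, _ => True
  | .atom p i, w => p ∈ N.V w i
  | .neg φ, w => ¬ etlSat N φ w
  | .conj φ ψ, w => etlSat N φ w ∧ etlSat N ψ w
  | .know i φ, w => ∀ v, N.sim i w v → etlSat N φ v
  | .box a φ, w => ∀ v, N.trans a w v → etlSat N φ v

/-- `Z` is a `G`-bisimulation between two epistemic models w.r.t. `G`. -/
def IsGBisim {W W' : Type} (G : GameData I A P S) (M : EpiData I A P S W)
    (N : EpiData I A P S W') (Z : W → W' → Prop) : Prop :=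
  ∀ w u, Z w u →
    M.f w = N.f u ∧
    (∀ i w', M.sim i w w' → ∃ u', N.sim i u u' ∧ Z w' u') ∧
    (∀ i u', N.sim i u u' → ∃ w', M.sim i w w' ∧ Z w' u')

/-- Pointed `G`-bisimilarity. -/
def GBisimilar {W W' : Type} (G : GameData I A P S) (M : EpiData I A P S W)
    (N : EpiData I A P S W') (w : W) (u : W') : Prop :=
  ∃ Z, IsGBisim G M N Z ∧ Z w u

/-- The proof system SIG. -/
inductive SIG (pl : A → I) (pa : A → P) (U : ObsModel I A) : LDEL I A P → Prop where
  | taut {φ : LDEL I A P} : (∀ v, propEval v φ) → SIG pl pa U φ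
  | distK (i : I) (φ ψ : LDEL I A P) :
      SIG pl pa U (impF (.know i (impF φ ψ)) (impF (.know i φ) (.know i ψ)))
  | distB (a : A) (φ ψ : LDEL I A P) :
      SIG pl pa U (impF (.box a (impF φ ψ)) (impF (.box a φ) (.box a ψ)))
  | axT (i : I) (φ : LDEL I A P) : SIG pl pa U (impF (.know i φ) φ)
  | ax4 (i : I) (φ : LDEL I A P) :
      SIG pl pa U (impF (.know i φ) (.know i (.know i φ)))
  | ax5 (i : I) (φ : LDEL I A P) :
      SIG pl pa U (impF (.neg (.know i φ)) (.know i (.neg (.know i φ))))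
  | nm (i : I) (a b : A) (φ : LDEL I A P) (B : Set P) (L1 L2 : List P)
      (h1 : ∀ p, p ∈ L1 ↔ p ∈ B) (h2 : ∀ p, p ∈ L2 ↔ p ∉ B) (hab : U.rel i a b) :
      SIG pl pa U (impF (khatF i (diaF b (.conj φ (charF i L1 L2))))
        (.box a (impF (charF i L1 L2) (khatF i φ))))
  | pr (i : I) (a : A) (φ : LDEL I A P) (L : List A) (hL : ∀ b, b ∈ L ↔ U.rel i a b) :
      SIG pl pa U (impF (diaF a (khatF i φ))
        (bigOr (L.map (fun b => khatF i (diaF b φ)))))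
  | det (a : A) (φ : LDEL I A P) : SIG pl pa U (impF (diaF a φ) (.box a φ))
  | exturn (i : I) (LA : I → List A) (hLA : ∀ j a, a ∈ LA j ↔ pl a = j)
      (LI : List I) (hLI : ∀ j, j ∈ LI ↔ j ≠ i) :
      SIG pl pa U (impF (turnF (LA i))
        (bigAnd (LI.map (fun j => LDEL.neg (turnF (LA j))))))
  | info (a : A) : SIG pl pa U (iffF (diaF a .top) (.atom (pa a) (pl a)))
  | ke (p : P) (i : I) :
      SIG pl pa U (.conj (impF (.atom p i) (.know i (.atom p i)))
        (impF (.neg (.atom p i)) (.know i (.neg (.atom p i)))))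
  | mp {φ ψ : LDEL I A P} : SIG pl pa U (impF φ ψ) → SIG pl pa U φ → SIG pl pa U ψ
  | necK (i : I) {φ : LDEL I A P} : SIG pl pa U φ → SIG pl pa U (.know i φ)
  | necB (a : A) {φ : LDEL I A P} : SIG pl pa U φ → SIG pl pa U (.box a φ)

/-- A set of formulas is SIG-inconsistent if the negation of the conjunction of some
finite list of its members is derivable. -/
def Inconsistent (pl : A → I) (pa : A → P) (U : ObsModel I A)
    (Γ : Set (LDEL I A P)) : Prop :=
  ∃ L : List (LDEL I A P), (∀ φ ∈ L, φ ∈ Γ) ∧ SIG pl pa U (.neg (bigAnd L))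

/-- Maximally SIG-consistent sets. -/
def MCS (pl : A → I) (pa : A → P) (U : ObsModel I A) (Γ : Set (LDEL I A P)) : Prop :=
  ¬ Inconsistent pl pa U Γ ∧ ∀ Δ, Γ ⊂ Δ → Inconsistent pl pa U Δ

/-- Carrier of the canonical model: all maximally consistent sets. -/
abbrev CanW (pl : A → I) (pa : A → P) (U : ObsModel I A) : Type :=
  {Γ : Set (LDEL I A P) // MCS pl pa U Γ}

/-- The canonical model of SIG. -/
def canonical (pl : A → I) (pa : A → P) (U : ObsModel I A) :
    ETLData I A P (CanW pl pa U) where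
  sim i w u := ∀ φ, LDEL.know i φ ∈ w.val → φ ∈ u.val
  trans a w u := ∀ φ, LDEL.box a φ ∈ w.val → φ ∈ u.val
  V w i := {p | LDEL.atom p i ∈ w.val}

end Lang

section Statements
variable {I A P S W W' : Type}

theorem dynSat_bigAnd (G : GameData I A P S) (U : ObsModel I A) (M : EpiData I A P S W) (w : W)
    (L : List (LDEL I A P)) :
    dynSat G U (bigAnd L) W M w ↔ ∀ ψ ∈ L, dynSat G U ψ W M w := by
  induction L with
  | nil => simp [bigAnd, dynSat]
  | cons ψ L ih => simp [bigAnd, dynSat, ih]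

/-- The characteristic formula of `B` holds exactly where the valuation of `i` is `B`. -/
theorem dynSat_charF (G : GameData I A P S) (U : ObsModel I A) (M : EpiData I A P S W) (w : W)
    (i : I) {B : Set P} {L1 L2 : List P}
    (h1 : ∀ p, p ∈ L1 ↔ p ∈ B) (h2 : ∀ p, p ∈ L2 ↔ p ∉ B) :
    dynSat G U (charF i L1 L2) W M w ↔ M.V w i = B := by
  simp only [charF, dynSat, dynSat_bigAnd, List.forall_mem_map, h1, h2]
  constructor
  · rintro ⟨hpos, hneg⟩
    exact Set.Subset.antisymm (fun p hp => by_contra fun hB => hneg p hB hp) hpos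
  · rintro rfl
    exact ⟨fun _ hp => hp, fun _ hp => hp⟩

theorem dynSat_impF (G : GameData I A P S) (U : ObsModel I A) (M : EpiData I A P S W) (w : W)
    (φ ψ : LDEL I A P) :
    dynSat G U (impF φ ψ) W M w ↔ (dynSat G U φ W M w → dynSat G U ψ W M w) := by
  simp [impF, dynSat]

theorem dynSat_khatF (G : GameData I A P S) (U : ObsModel I A) (M : EpiData I A P S W) (w : W)
    (i : I) (φ : LDEL I A P) :
    dynSat G U (khatF i φ) W M w ↔ ∃ v, M.sim i w v ∧ dynSat G U φ W M v := by
  simp [khatF, dynSat]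

theorem dynSat_diaF (G : GameData I A P S) (U : ObsModel I A) (M : EpiData I A P S W) (w : W)
    (a : A) (φ : LDEL I A P) :
    dynSat G U (diaF a φ) W M w ↔ ∃ h : (G.R (M.f w) a).isSome,
      dynSat G U φ (UpdW G M) (update G U M) ⟨(w, a), h⟩ := by
  simp [diaF, dynSat]

theorem statement14 [Fintype I] [Fintype A] [Fintype P] [Nonempty I] [Nonempty A]
    (pl : A → I) (pa : A → P) (U : ObsModel I A)
    (i : I) (a b : A) (hab : U.rel i a b) (φ : LDEL I A P)
    (B : Set P) (L1 L2 : List P)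
    (h1 : ∀ p, p ∈ L1 ↔ p ∈ B) (h2 : ∀ p, p ∈ L2 ↔ p ∉ B) :
    ∀ (S : Type) (G : GameData I A P S), IsGameStructure pl pa G →
      ∀ (W : Type) (M : EpiData I A P S W), IsEpiModel G M →
        ∀ w : W, dynSat G U
          (impF (khatF i (diaF b (.conj φ (charF i L1 L2))))
            (.box a (impF (charF i L1 L2) (khatF i φ)))) W M w := by
  intro S G _ W M _ w
  rw [dynSat_impF, dynSat_khatF]
  rintro ⟨v, hwv, hv⟩ ha
  obtain ⟨hb, hφ, hbB⟩ := (dynSat_diaF ..).1 hv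
  rw [dynSat_impF, dynSat_khatF]
  intro haB
  rw [dynSat_charF G U _ _ i h1 h2] at haB hbB
  exact ⟨⟨(v, b), hb⟩, ⟨hwv, hab, haB.trans hbB.symm⟩, hφ⟩

end Statements
end GameRuns
end

section
/- (Validity of the perfect recall axiom) For every i ∈ I, every a ∈ A and every LDEL formula φ, the formula ⟨a⟩K̂_i φ → ⋁_{b : a ↭_i b} K̂_i⟨b⟩φ holds at every world of every epistemic model with respect to every game structure under the dynamic semantics ⊨. -/
namespace GameRuns

variable {I A P S : Type}

section Statements
variable {I A P S W W' : Type}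

/-- A finite disjunction holds as soon as one of its disjuncts does. -/
theorem dynSat_bigOr_of_mem (G : GameData I A P S) (U : ObsModel I A)
    (M : EpiData I A P S W) (w : W) {l : List (LDEL I A P)} {ψ : LDEL I A P}
    (hψ : ψ ∈ l) (hw : dynSat G U ψ W M w) : dynSat G U (bigOr l) W M w := by
  induction l with
  | nil => simp at hψ
  | cons χ l ih =>
    simp only [bigOr, orF, dynSat]
    rintro ⟨hχ, hl⟩
    rcases List.mem_cons.mp hψ with rfl | h
    · exact hχ hw
    · exact hl (ih h)

theorem statement15 [Fintype I] [Fintype A] [Fintype P] [Nonempty I] [Nonempty A]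
    (pl : A → I) (pa : A → P) (U : ObsModel I A)
    (i : I) (a : A) (φ : LDEL I A P)
    (L : List A) (hL : ∀ b, b ∈ L ↔ U.rel i a b) :
    ∀ (S : Type) (G : GameData I A P S), IsGameStructure pl pa G →
      ∀ (W : Type) (M : EpiData I A P S W), IsEpiModel G M →
        ∀ w : W, dynSat G U
          (impF (diaF a (khatF i φ))
            (bigOr (L.map (fun b => khatF i (diaF b φ))))) W M w := by
  intro S G _ W M _ w
  simp only [impF, diaF, khatF, dynSat]
  rintro ⟨hdia, hor⟩
  refine hdia fun h hkhat => hkhat ?_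
  rintro ⟨⟨v, b⟩, hb⟩ ⟨hwv, hab, -⟩ hφ
  refine hor (dynSat_bigOr_of_mem G U M w
    (List.mem_map.mpr ⟨b, (hL b).mpr hab, rfl⟩) ?_)
  simp only [dynSat]
  exact fun hk => hk v hwv fun hbox => hbox hb hφ

end Statements
end GameRuns
end

section
/- The canonical model N^C = (W^C, ≃, ↣, V^C) of SIG is a normal epistemic temporal model with respect to U. -/
namespace GameRuns

variable {I A P S : Type}

section Canonical
variable {I A P : Type} {pl : A → I} {pa : A → P} {U : ObsModel I A}

@[simp] theorem propEval_top (v : LDEL I A P → Prop) : propEval v .top ↔ True := Iff.rfl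

@[simp] theorem propEval_neg (v : LDEL I A P → Prop) (φ : LDEL I A P) :
    propEval v (.neg φ) ↔ ¬ propEval v φ := Iff.rfl

@[simp] theorem propEval_conj (v : LDEL I A P → Prop) (φ ψ : LDEL I A P) :
    propEval v (.conj φ ψ) ↔ propEval v φ ∧ propEval v ψ := Iff.rfl

@[simp] theorem propEval_impF (v : LDEL I A P → Prop) (φ ψ : LDEL I A P) :
    propEval v (impF φ ψ) ↔ (propEval v φ → propEval v ψ) := by
  simp [impF]

@[simp] theorem propEval_orF (v : LDEL I A P → Prop) (φ ψ : LDEL I A P) :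
    propEval v (orF φ ψ) ↔ (propEval v φ ∨ propEval v ψ) := by
  simp only [orF, propEval_neg, propEval_conj]
  tauto

@[simp] theorem propEval_bigAnd (v : LDEL I A P → Prop) (L : List (LDEL I A P)) :
    propEval v (bigAnd L) ↔ ∀ φ ∈ L, propEval v φ := by
  induction L with
  | nil => simp [bigAnd]
  | cons φ L ih => simp [bigAnd, ih]

@[simp] theorem propEval_bigOr (v : LDEL I A P → Prop) (L : List (LDEL I A P)) :
    propEval v (bigOr L) ↔ ∃ φ ∈ L, propEval v φ := by
  induction L with
  | nil => simp [bigOr]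
  | cons φ L ih => simp [bigOr, ih]

/-- Derivability is closed under propositional consequence from one premise. -/
theorem SIG.of_propEval {φ ψ : LDEL I A P} (hφ : SIG pl pa U φ)
    (h : ∀ v, propEval v φ → propEval v ψ) : SIG pl pa U ψ :=
  .mp (.taut fun v => (propEval_impF v φ ψ).2 (h v)) hφ

/-- Derivability is closed under propositional consequence from two premises. -/
theorem SIG.of_propEval₂ {φ χ ψ : LDEL I A P} (hφ : SIG pl pa U φ) (hχ : SIG pl pa U χ)
    (h : ∀ v, propEval v φ → propEval v χ → propEval v ψ) : SIG pl pa U ψ :=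
  .mp (hφ.of_propEval (ψ := impF χ ψ) fun v hv => (propEval_impF v χ ψ).2 (h v hv)) hχ

namespace MCS
variable {Γ : Set (LDEL I A P)}

theorem mem_of_derivable_of_list (hΓ : MCS pl pa U Γ) {L : List (LDEL I A P)} {φ : LDEL I A P}
    (hL : ∀ ψ ∈ L, ψ ∈ Γ) (h : SIG pl pa U (impF (bigAnd L) φ)) : φ ∈ Γ := by
  classical
  by_contra hφ
  obtain ⟨L', hL', hd⟩ := hΓ.2 (insert φ Γ) (Set.ssubset_insert hφ)
  refine hΓ.1 ⟨L ++ L'.filter (· ≠ φ), ?_, h.of_propEval₂ hd ?_⟩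
  · intro ψ hψ
    simp only [ne_eq, decide_not, List.mem_append, List.mem_filter, Bool.not_eq_eq_eq_not,
      Bool.not_true, decide_eq_false_iff_not] at hψ
    rcases hψ with hψ | ⟨hψ, hne⟩
    · exact hL ψ hψ
    · exact (hL' ψ hψ).resolve_left hne
  · intro v h₁ h₂
    simp only [propEval_impF, propEval_bigAnd, propEval_neg] at h₁ h₂ ⊢
    intro h₃
    refine h₂ fun ψ hψ => ?_
    by_cases hne : ψ = φ
    · rw [hne]
      exact h₁ fun χ hχ => h₃ χ (List.mem_append_left _ hχ)
    · exact h₃ ψ (List.mem_append_right _ (by simp [hψ, hne]))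

theorem mem_of_derivable (hΓ : MCS pl pa U Γ) {φ : LDEL I A P} (h : SIG pl pa U φ) : φ ∈ Γ :=
  hΓ.mem_of_derivable_of_list (L := []) (by simp) (h.of_propEval fun v hv => by simpa using hv)

theorem neg_mem_iff (hΓ : MCS pl pa U Γ) (φ : LDEL I A P) : LDEL.neg φ ∈ Γ ↔ φ ∉ Γ := by
  classical
  constructor
  · intro hn hφ
    exact hΓ.1 ⟨[φ, .neg φ], by simp [hn, hφ], .taut fun v => by simp⟩
  · intro hφ
    obtain ⟨L, hL, hd⟩ := hΓ.2 (insert φ Γ) (Set.ssubset_insert hφ)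
    refine hΓ.mem_of_derivable_of_list (L := L.filter (· ≠ φ)) ?_ (hd.of_propEval ?_)
    · intro ψ hψ
      simp only [ne_eq, decide_not, List.mem_filter, Bool.not_eq_eq_eq_not,
        Bool.not_true, decide_eq_false_iff_not] at hψ
      exact (hL ψ hψ.1).resolve_left hψ.2
    · intro v h
      simp only [propEval_impF, propEval_bigAnd, propEval_neg] at h ⊢
      intro h₁ h₂
      refine h fun ψ hψ => ?_
      by_cases hne : ψ = φ
      · rwa [hne]
      · exact h₁ ψ (by simp [hψ, hne])

theorem conj_mem_iff (hΓ : MCS pl pa U Γ) (φ ψ : LDEL I A P) :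
    LDEL.conj φ ψ ∈ Γ ↔ φ ∈ Γ ∧ ψ ∈ Γ := by
  refine ⟨fun h => ⟨?_, ?_⟩, fun h => ?_⟩
  · exact hΓ.mem_of_derivable_of_list (L := [.conj φ ψ]) (by simp [h])
      (.taut fun v => by simpa using fun h _ => h)
  · exact hΓ.mem_of_derivable_of_list (L := [.conj φ ψ]) (by simp [h])
      (.taut fun v => by simp)
  · exact hΓ.mem_of_derivable_of_list (L := [φ, ψ]) (by simp [h])
      (.taut fun v => by simp)

theorem propEval_mem_iff (hΓ : MCS pl pa U Γ) (φ : LDEL I A P) :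
    propEval (· ∈ Γ) φ ↔ φ ∈ Γ := by
  induction φ with
  | top => exact iff_of_true trivial (hΓ.mem_of_derivable (.taut fun _ => trivial))
  | neg φ ih => rw [propEval_neg, ih, hΓ.neg_mem_iff]
  | conj φ ψ ih₁ ih₂ => rw [propEval_conj, ih₁, ih₂, hΓ.conj_mem_iff]
  | atom | know | box => exact Iff.rfl

theorem top_mem (hΓ : MCS pl pa U Γ) : LDEL.top ∈ Γ :=
  hΓ.mem_of_derivable (.taut fun _ => trivial)

theorem impF_mem_iff (hΓ : MCS pl pa U Γ) (φ ψ : LDEL I A P) :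
    impF φ ψ ∈ Γ ↔ (φ ∈ Γ → ψ ∈ Γ) := by
  rw [← hΓ.propEval_mem_iff, propEval_impF, hΓ.propEval_mem_iff, hΓ.propEval_mem_iff]

theorem bigAnd_mem_iff (hΓ : MCS pl pa U Γ) (L : List (LDEL I A P)) :
    bigAnd L ∈ Γ ↔ ∀ φ ∈ L, φ ∈ Γ := by
  rw [← hΓ.propEval_mem_iff, propEval_bigAnd]
  simp only [hΓ.propEval_mem_iff]

theorem bigOr_mem_iff (hΓ : MCS pl pa U Γ) (L : List (LDEL I A P)) :
    bigOr L ∈ Γ ↔ ∃ φ ∈ L, φ ∈ Γ := by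
  rw [← hΓ.propEval_mem_iff, propEval_bigOr]
  simp only [hΓ.propEval_mem_iff]

theorem mem_of_imp (hΓ : MCS pl pa U Γ) {φ ψ : LDEL I A P} (h : SIG pl pa U (impF φ ψ))
    (hφ : φ ∈ Γ) : ψ ∈ Γ :=
  (hΓ.impF_mem_iff φ ψ).1 (hΓ.mem_of_derivable h) hφ

theorem charF_mem_iff (hΓ : MCS pl pa U Γ) (i : I) {B : Set P} {L₁ L₂ : List P}
    (h₁ : ∀ p, p ∈ L₁ ↔ p ∈ B) (h₂ : ∀ p, p ∈ L₂ ↔ p ∉ B) :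
    charF i L₁ L₂ ∈ Γ ↔ {p | LDEL.atom p i ∈ Γ} = B := by
  simp only [charF, hΓ.conj_mem_iff, hΓ.bigAnd_mem_iff, List.forall_mem_map, h₁, h₂,
    hΓ.neg_mem_iff, Set.ext_iff, Set.mem_ofPred_eq]
  exact ⟨fun h p => ⟨fun hp => by_contra fun hB => h.2 p hB hp, h.1 p⟩,
    fun h => ⟨fun p => (h p).2, fun p hp hB => hp ((h p).1 hB)⟩⟩

/-- The dual of an operator holds of every member of an accessible world. -/
theorem dual_mem {Δ : Set (LDEL I A P)} (hΓ : MCS pl pa U Γ) (hΔ : MCS pl pa U Δ)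
    {m : LDEL I A P → LDEL I A P} (h : ∀ ψ, m ψ ∈ Γ → ψ ∈ Δ) {φ : LDEL I A P}
    (hφ : φ ∈ Δ) : LDEL.neg (m (.neg φ)) ∈ Γ :=
  (hΓ.neg_mem_iff _).2 fun hn => (hΔ.neg_mem_iff φ).1 (h _ hn) hφ

end MCS

/-- Lindenbaum's lemma: every consistent set extends to a maximally consistent one. -/
theorem exists_mcs_of_consistent {Γ : Set (LDEL I A P)} (hΓ : ¬ Inconsistent pl pa U Γ) :
    ∃ Δ, Γ ⊆ Δ ∧ MCS pl pa U Δ := by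
  obtain ⟨Δ, hΔ, hmax⟩ := zorn_subset_nonempty {Δ | ¬ Inconsistent pl pa U Δ} (by
    intro c hc hchain hne
    refine ⟨⋃₀ c, ?_, fun s hs => Set.subset_sUnion_of_mem hs⟩
    rintro ⟨L, hL, hd⟩
    obtain ⟨s, hs, hLs⟩ := hchain.directedOn.exists_mem_subset_of_finset_subset_biUnion
      (f := id) hne (s := L.finite_toSet.toFinset)
      (by
        intro φ hφ
        obtain ⟨s, hs, hφs⟩ := hL φ (by simpa using hφ)
        exact Set.mem_biUnion hs hφs)
    exact hc hs ⟨L, fun φ hφ => hLs (by simpa using hφ), hd⟩) Γ hΓ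
  refine ⟨Δ, hΔ, hmax.prop, fun Θ hΘ => by_contra fun h => ?_⟩
  exact hΘ.2 (hmax.2 h hΘ.1)

/-- The axiom of distribution and the rule of necessitation for a unary operator. -/
structure NormalModality (pl : A → I) (pa : A → P) (U : ObsModel I A)
    (m : LDEL I A P → LDEL I A P) : Prop where
  dist : ∀ φ ψ, SIG pl pa U (impF (m (impF φ ψ)) (impF (m φ) (m ψ)))
  nec : ∀ {φ}, SIG pl pa U φ → SIG pl pa U (m φ)

theorem normalModality_know (i : I) : NormalModality pl pa U (LDEL.know i) :=
  ⟨.distK i, .necK i⟩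

theorem normalModality_box (a : A) : NormalModality pl pa U (LDEL.box a) :=
  ⟨.distB a, .necB a⟩

namespace NormalModality
variable {m : LDEL I A P → LDEL I A P}

theorem imp (hm : NormalModality pl pa U m) {φ ψ : LDEL I A P} (h : SIG pl pa U (impF φ ψ)) :
    SIG pl pa U (impF (m φ) (m ψ)) :=
  .mp (hm.dist φ ψ) (hm.nec h)

theorem dual_imp (hm : NormalModality pl pa U m) {φ ψ : LDEL I A P}
    (h : SIG pl pa U (impF φ ψ)) :
    SIG pl pa U (impF (.neg (m (.neg φ))) (.neg (m (.neg ψ)))) :=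
  (hm.imp (h.of_propEval (ψ := impF (.neg ψ) (.neg φ)) fun v hv => by
    simp only [propEval_impF, propEval_neg] at hv ⊢
    tauto)).of_propEval fun v hv => by
      simp only [propEval_impF, propEval_neg] at hv ⊢
      tauto

theorem mem_of_list (hm : NormalModality pl pa U m) {Γ : Set (LDEL I A P)}
    (hΓ : MCS pl pa U Γ) {L : List (LDEL I A P)} (hL : ∀ ψ ∈ L, m ψ ∈ Γ) {φ : LDEL I A P}
    (h : SIG pl pa U (impF (bigAnd L) φ)) : m φ ∈ Γ := by
  induction L generalizing φ with
  | nil => exact hΓ.mem_of_derivable (hm.nec (h.of_propEval fun v hv => by simpa using hv))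
  | cons ψ L ih =>
    have h₁ : m (impF ψ φ) ∈ Γ := ih (fun χ hχ => hL χ (List.mem_cons_of_mem _ hχ))
      (h.of_propEval fun v hv => by
        simp only [propEval_impF, propEval_bigAnd, List.forall_mem_cons] at hv ⊢
        exact fun h₁ h₂ => hv ⟨h₂, h₁⟩)
    exact (hΓ.impF_mem_iff _ _).1 (hΓ.mem_of_imp (hm.dist ψ φ) h₁) (hL ψ List.mem_cons_self)

/-- The existence lemma for a normal modality. -/
theorem exists_mcs_of_notMem (hm : NormalModality pl pa U m) {Γ : Set (LDEL I A P)}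
    (hΓ : MCS pl pa U Γ) {φ : LDEL I A P} (hφ : m φ ∉ Γ) :
    ∃ Δ, MCS pl pa U Δ ∧ (∀ ψ, m ψ ∈ Γ → ψ ∈ Δ) ∧ φ ∉ Δ := by
  classical
  obtain ⟨Δ, hsub, hΔ⟩ := exists_mcs_of_consistent (pl := pl) (pa := pa) (U := U)
    (Γ := insert (.neg φ) {ψ | m ψ ∈ Γ}) (by
      rintro ⟨L, hL, hd⟩
      refine hφ (hm.mem_of_list hΓ (L := L.filter (· ≠ .neg φ)) ?_ (hd.of_propEval ?_))
      · intro ψ hψ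
        simp only [ne_eq, decide_not, List.mem_filter, Bool.not_eq_eq_eq_not,
          Bool.not_true, decide_eq_false_iff_not] at hψ
        exact (hL ψ hψ.1).resolve_left hψ.2
      · intro v h
        simp only [propEval_impF, propEval_bigAnd, propEval_neg] at h ⊢
        intro h₁
        by_contra h₂
        refine h fun ψ hψ => ?_
        by_cases hne : ψ = .neg φ
        · rwa [hne]
        · exact h₁ ψ (by simp [hψ, hne]))
  exact ⟨Δ, hΔ, fun ψ hψ => hsub (Set.mem_insert_of_mem _ hψ),
    (hΔ.neg_mem_iff φ).1 (hsub (Set.mem_insert _ _))⟩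

/-- If the dual holds of every member of a maximally consistent set, that set is accessible. -/
theorem mem_of_dual_mem (hm : NormalModality pl pa U m) {Γ Δ : Set (LDEL I A P)}
    (hΓ : MCS pl pa U Γ) (hΔ : MCS pl pa U Δ)
    (h : ∀ ψ ∈ Δ, LDEL.neg (m (.neg ψ)) ∈ Γ) {φ : LDEL I A P} (hφ : m φ ∈ Γ) : φ ∈ Δ := by
  by_contra hn
  refine (hΓ.neg_mem_iff _).1 (h _ ((hΔ.neg_mem_iff φ).2 hn)) ?_
  exact hΓ.mem_of_imp (hm.imp (.taut fun v => by simp)) hφ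

end NormalModality

/-- SIG is sound for the one-state model without transitions in which no piece holds. -/
theorem SIG.etlSat_unit {φ : LDEL I A P} (h : SIG pl pa U φ) :
    etlSat (⟨fun _ _ _ => True, fun _ _ _ => False, fun _ _ => ∅⟩ : ETLData I A P Unit) φ () := by
  set N : ETLData I A P Unit := ⟨fun _ _ _ => True, fun _ _ _ => False, fun _ _ => ∅⟩
  have hbox : ∀ a φ, etlSat N (.box a φ) () := fun a φ v hv => hv.elim
  have hturn : ∀ l : List A, ¬ etlSat N (turnF l) () := by
    intro l
    induction l with
    | nil => exact fun h => h trivial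
    | cons a l ih => exact fun h => h ⟨fun h' => h' (hbox a _), ih⟩
  induction h with
  | @taut φ h =>
    have heval : ∀ φ, propEval (fun ψ => etlSat N ψ ()) φ ↔ etlSat N φ () := by
      intro φ
      induction φ with
      | top => exact Iff.rfl
      | neg φ ih => exact not_congr ih
      | conj φ ψ ih₁ ih₂ => exact and_congr ih₁ ih₂
      | atom | know | box => exact Iff.rfl
    exact (heval φ).1 (h _)
  | distK i φ ψ =>
    simp only [impF, etlSat]
    exact fun h => h.2 fun h' => h'.2 fun v hv => not_not.1 fun hn => h.1 v hv ⟨h'.1 v hv, hn⟩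
  | distB a φ ψ => exact fun h => h.2 fun h' => h'.2 (hbox a ψ)
  | axT i φ => exact fun h => h.2 (h.1 () trivial)
  | ax4 i φ => exact fun h => h.2 fun _ _ => h.1
  | ax5 i φ => exact fun h => h.2 fun _ _ => h.1
  | nm i a b φ B L1 L2 h1 h2 hab => exact fun h => h.2 (hbox a _)
  | pr i a φ L hL => exact fun h => h.1 (hbox a _)
  | det a φ => exact fun h => h.2 (hbox a _)
  | exturn i LA hLA LI hLI => exact fun h => hturn _ h.1
  | info a => exact ⟨fun h => h.1 (hbox a _), fun h => h.1⟩
  | ke p i => exact ⟨fun h => h.1, fun h => h.2 fun _ _ => h.1⟩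
  | mp _ _ ih₁ ih₂ => exact not_not.1 fun h => ih₁ ⟨ih₂, h⟩
  | necK i _ ih => exact fun _ _ => ih
  | necB a _ _ => exact hbox a _

theorem nonempty_canW : Nonempty (CanW pl pa U) := by
  obtain ⟨Δ, -, hΔ⟩ := exists_mcs_of_consistent (pl := pl) (pa := pa) (U := U) (Γ := ∅) (by
    rintro ⟨L, hL, hd⟩
    obtain rfl := List.eq_nil_iff_forall_not_mem.2 hL
    exact hd.etlSat_unit trivial)
  exact ⟨⟨Δ, hΔ⟩⟩

theorem canonical_sim_equivalence (i : I) : Equivalence ((canonical pl pa U).sim i) where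
  refl w φ h := w.2.mem_of_imp (.axT i φ) h
  symm {w u} h φ hφ := by
    by_contra hn
    have hK : LDEL.know i φ ∉ w.1 := fun hK => hn (w.2.mem_of_imp (.axT i φ) hK)
    exact (u.2.neg_mem_iff _).1
      (h _ (w.2.mem_of_imp (.ax5 i φ) ((w.2.neg_mem_iff _).2 hK))) hφ
  trans {w u v} h₁ h₂ φ hφ := h₂ _ (h₁ _ (w.2.mem_of_imp (.ax4 i φ) hφ))

theorem canonical_isETL : IsETL (canonical pl pa U) :=
  ⟨nonempty_canW, canonical_sim_equivalence⟩

theorem diaF_mem_of_trans {a : A} {s t : CanW pl pa U} (h : (canonical pl pa U).trans a s t)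
    {φ : LDEL I A P} (hφ : φ ∈ t.1) : diaF a φ ∈ s.1 :=
  s.2.dual_mem t.2 h hφ

theorem khatF_mem_of_sim {i : I} {s t : CanW pl pa U} (h : (canonical pl pa U).sim i s t)
    {φ : LDEL I A P} (hφ : φ ∈ t.1) : khatF i φ ∈ s.1 :=
  s.2.dual_mem t.2 h hφ

theorem exists_trans_iff {a : A} {s : CanW pl pa U} :
    (∃ t, (canonical pl pa U).trans a s t) ↔ diaF a .top ∈ s.1 := by
  constructor
  · rintro ⟨t, ht⟩
    exact diaF_mem_of_trans ht t.2.top_mem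
  · intro h
    obtain ⟨Δ, hΔ, hsub, -⟩ :=
      (normalModality_box a).exists_mcs_of_notMem s.2 ((s.2.neg_mem_iff _).1 h)
    exact ⟨⟨Δ, hΔ⟩, hsub⟩

theorem canonical_noMiracles [Finite P] {i : I} {a b : A} {s s' t t' : CanW pl pa U}
    (hs : (canonical pl pa U).sim i s s') (ha : (canonical pl pa U).trans a s' t')
    (hb : (canonical pl pa U).trans b s t) (hab : U.rel i b a)
    (hV : (canonical pl pa U).V t i = (canonical pl pa U).V t' i) :
    (canonical pl pa U).sim i t t' := by
  intro φ hφ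
  by_contra hn
  set B : Set P := {p | LDEL.atom p i ∈ t'.1}
  have h₁ : ∀ p, p ∈ B.toFinite.toFinset.toList ↔ p ∈ B := by simp
  have h₂ : ∀ p, p ∈ Bᶜ.toFinite.toFinset.toList ↔ p ∉ B := by simp
  have hdia := diaF_mem_of_trans ha ((t'.2.conj_mem_iff _ _).2
    ⟨(t'.2.neg_mem_iff φ).2 hn, (t'.2.charF_mem_iff i h₁ h₂).2 rfl⟩)
  have himp := hb _ (s.2.mem_of_imp (.nm i b a (.neg φ) B _ _ h₁ h₂ hab)
    (khatF_mem_of_sim hs hdia))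
  have hkhat := (t.2.impF_mem_iff _ _).1 himp ((t.2.charF_mem_iff i h₁ h₂).2 hV)
  exact (t.2.neg_mem_iff _).1 hkhat
    (t.2.mem_of_imp ((normalModality_know i).imp (.taut fun v => by simp)) hφ)

/-- A world `s` at which `K̂_i⟨b⟩ψ` holds for every `ψ` in `t'` is `i`-indistinguishable from a
`b`-predecessor of `t'`. -/
theorem exists_sim_trans {i : I} {b : A} {s t' : CanW pl pa U}
    (h : ∀ ψ ∈ t'.1, khatF i (diaF b ψ) ∈ s.1) :
    ∃ s', (canonical pl pa U).sim i s s' ∧ (canonical pl pa U).trans b s' t' := by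
  have hlist : ∀ L : List (LDEL I A P),
      (∀ φ ∈ L, φ ∈ {φ | LDEL.know i φ ∈ s.1} ∪ diaF b '' t'.1) →
      ∃ ψ ∈ t'.1, LDEL.know i (impF (diaF b ψ) (bigAnd L)) ∈ s.1 := by
    intro L
    induction L with
    | nil =>
      exact fun _ => ⟨.top, t'.2.top_mem,
        s.2.mem_of_derivable (.necK i (.taut fun v => by simp))⟩
    | cons φ L ih =>
      intro hL
      obtain ⟨hφ, hL⟩ := List.forall_mem_cons.1 hL
      obtain ⟨ψ, hψ, hK⟩ := ih hL
      rcases hφ with hφ | ⟨χ, hχ, rfl⟩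
      · refine ⟨ψ, hψ, (normalModality_know i).mem_of_list s.2
          (L := [φ, impF (diaF b ψ) (bigAnd L)]) ?_ (.taut fun v => ?_)⟩
        · simpa using ⟨hφ, hK⟩
        · simp only [bigAnd, propEval_impF, propEval_conj, propEval_top]
          tauto
      · refine ⟨.conj χ ψ, (t'.2.conj_mem_iff _ _).2 ⟨hχ, hψ⟩,
          s.2.mem_of_imp ((normalModality_know i).imp ?_) hK⟩
        have hl : SIG pl pa U (impF (diaF b (.conj χ ψ)) (diaF b χ)) :=
          (normalModality_box b).dual_imp (.taut fun v => by simpa using fun h _ => h)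
        have hr : SIG pl pa U (impF (diaF b (.conj χ ψ)) (diaF b ψ)) :=
          (normalModality_box b).dual_imp (.taut fun v => by simp)
        refine hl.of_propEval₂ hr fun v h₁ h₂ => ?_
        simp only [bigAnd, propEval_impF, propEval_conj] at h₁ h₂ ⊢
        tauto
  obtain ⟨Δ, hsub, hΔ⟩ := exists_mcs_of_consistent (pl := pl) (pa := pa) (U := U)
    (Γ := {φ | LDEL.know i φ ∈ s.1} ∪ diaF b '' t'.1) (by
      rintro ⟨L, hL, hd⟩
      obtain ⟨ψ, hψ, hK⟩ := hlist L hL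
      refine (s.2.neg_mem_iff _).1 (h ψ hψ)
        (s.2.mem_of_imp ((normalModality_know i).imp (hd.of_propEval fun v hv => ?_)) hK)
      simp only [propEval_impF, propEval_neg] at hv ⊢
      tauto)
  exact ⟨⟨Δ, hΔ⟩, fun φ hφ => hsub (Or.inl hφ), fun φ hφ =>
    (normalModality_box b).mem_of_dual_mem hΔ t'.2
      (fun ψ hψ => hsub (Or.inr ⟨ψ, hψ, rfl⟩)) hφ⟩

theorem canonical_perfectRecall [Finite A] {i : I} {a : A} {s t t' : CanW pl pa U}
    (ha : (canonical pl pa U).trans a s t) (ht : (canonical pl pa U).sim i t t') :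
    ∃ s' b, (canonical pl pa U).sim i s s' ∧ U.rel i a b ∧
      (canonical pl pa U).trans b s' t' := by
  obtain ⟨b, hb, hK⟩ : ∃ b, U.rel i a b ∧ ∀ ψ ∈ t'.1, khatF i (diaF b ψ) ∈ s.1 := by
    by_contra! hcon
    have : Inhabited (LDEL I A P) := ⟨.top⟩
    choose! f hf hfK using hcon
    set L := {b | U.rel i a b}.toFinite.toFinset.toList
    have hL : ∀ b, b ∈ L ↔ U.rel i a b := by simp [L]
    have hand : bigAnd (L.map f) ∈ t'.1 :=
      (t'.2.bigAnd_mem_iff _).2 (List.forall_mem_map.2 fun b hb => hf b ((hL b).1 hb))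
    have hor := s.2.mem_of_imp (.pr i a _ L hL) (diaF_mem_of_trans ha (khatF_mem_of_sim ht hand))
    obtain ⟨χ, hχ, hχs⟩ := (s.2.bigOr_mem_iff _).1 hor
    obtain ⟨b, hb, rfl⟩ := List.mem_map.1 hχ
    refine hfK b ((hL b).1 hb) (s.2.mem_of_imp ((normalModality_know i).dual_imp
      ((normalModality_box b).dual_imp (.taut fun v => ?_))) hχs)
    rw [propEval_impF, propEval_bigAnd]
    exact fun h => h _ (List.mem_map_of_mem hb)
  obtain ⟨s', hs', hbt⟩ := exists_sim_trans hK
  exact ⟨s', b, hs', hb, hbt⟩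

theorem canonical_deterministic {a : A} {s t t' : CanW pl pa U}
    (h : (canonical pl pa U).trans a s t) (h' : (canonical pl pa U).trans a s t') : t = t' :=
  Subtype.ext (Set.Subset.antisymm
    (fun φ hφ => h' _ (s.2.mem_of_imp (.det a φ) (diaF_mem_of_trans h hφ)))
    (fun φ hφ => h _ (s.2.mem_of_imp (.det a φ) (diaF_mem_of_trans h' hφ))))

theorem canonical_exclusiveTurns [Finite I] [Finite A] {a b : A} {s : CanW pl pa U}
    (ha : a ∈ Act (canonical pl pa U) s) (hb : b ∈ Act (canonical pl pa U) s) :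
    pl a = pl b := by
  by_contra hne
  set LA : I → List A := fun j => {c | pl c = j}.toFinite.toFinset.toList
  have hLA : ∀ j c, c ∈ LA j ↔ pl c = j := by simp [LA]
  set LI : List I := {j | j ≠ pl a}.toFinite.toFinset.toList
  have hLI : ∀ j, j ∈ LI ↔ j ≠ pl a := by simp [LI]
  have hturn : ∀ {c}, c ∈ Act (canonical pl pa U) s → turnF (LA (pl c)) ∈ s.1 := fun {c} hc =>
    (s.2.bigOr_mem_iff _).2
      ⟨_, List.mem_map_of_mem ((hLA _ c).2 rfl), exists_trans_iff.1 hc⟩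
  have hall := (s.2.bigAnd_mem_iff _).1
    (s.2.mem_of_imp (.exturn (pl a) LA hLA LI hLI) (hturn ha))
  exact (s.2.neg_mem_iff _).1
    (hall _ (List.mem_map_of_mem ((hLI (pl b)).2 (Ne.symm hne)))) (hturn hb)

theorem canonical_info (a : A) (s : CanW pl pa U) :
    pa a ∈ (canonical pl pa U).V s (pl a) ↔ ∃ t, (canonical pl pa U).trans a s t := by
  obtain ⟨h₁, h₂⟩ := (s.2.conj_mem_iff _ _).1 (s.2.mem_of_derivable (.info a))
  rw [exists_trans_iff]
  exact ⟨(s.2.impF_mem_iff _ _).1 h₂, (s.2.impF_mem_iff _ _).1 h₁⟩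

theorem canonical_V_eq_of_sim {i : I} {w v : CanW pl pa U}
    (h : (canonical pl pa U).sim i w v) :
    (canonical pl pa U).V w i = (canonical pl pa U).V v i := by
  ext p
  obtain ⟨h₁, h₂⟩ := (w.2.conj_mem_iff _ _).1 (w.2.mem_of_derivable (.ke p i))
  refine ⟨fun hp => h _ ((w.2.impF_mem_iff _ _).1 h₁ hp), fun hp => by_contra fun hn => ?_⟩
  exact (v.2.neg_mem_iff _).1
    (h _ ((w.2.impF_mem_iff _ _).1 h₂ ((w.2.neg_mem_iff _).2 hn))) hp

end Canonical

section Statements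
variable {I A P S W W' : Type}

theorem statement17 [Fintype I] [Fintype A] [Fintype P] [Nonempty I] [Nonempty A]
    (pl : A → I) (pa : A → P) (U : ObsModel I A) :
    IsETL (canonical pl pa U) ∧ Normal pl pa U (canonical pl pa U) := by
  refine ⟨canonical_isETL, ?_, ?_, ?_, ?_, ?_, ?_⟩
  · exact fun i a b s s' t t' => canonical_noMiracles
  · exact fun i a s t t' => canonical_perfectRecall
  · exact fun a s t t' => canonical_deterministic
  · exact fun s ⟨a, ha⟩ => ⟨pl a, fun b hb => canonical_exclusiveTurns hb ha⟩
  · exact fun s a => canonical_info a s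
  · exact fun i w v => canonical_V_eq_of_sim

end Statements
end GameRuns
end
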